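/- For any two ordinals λ₀ and λ₁, the product λ₀ × λ₁ with the componentwise order (whose lattice operations are coordinatewise maximum and minimum) is a lattice of degree 2: for every (α, β) ∈ λ₀ × λ₁ and any three elements x₁, x₂, x₃ < (α, β) there are indices 1 ≤ i ≠ j ≤ 3 and an element e < (α, β) with x_i ≤ e and x_j ≤ e. -/

import Mathlib

/-- A (pre)ordered set has *degree 2* if for every `d` and any `x₁, x₂, x₃ < d` there are
two of the three elements admitting a common upper bound `e < d`. -/
def Degree2 (α : Type*) [Preorder α] : Prop :=
  ∀ d x₁ x₂ x₃ : α, x₁ < d → x₂ < d → x₃ < d →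
    ∃ e, e < d ∧ ((x₁ ≤ e ∧ x₂ ≤ e) ∨ (x₁ ≤ e ∧ x₃ ≤ e) ∨ (x₂ ≤ e ∧ x₃ ≤ e))

section LinearOrder

variable {α β : Type*} [LinearOrder α] [LinearOrder β] {d x y : α × β}

theorem Prod.sup_lt_of_fst_lt (hx : x < d) (hy : y < d) (hx₁ : x.1 < d.1) (hy₁ : y.1 < d.1) :
    x ⊔ y < d :=
  Prod.lt_iff.2 (Or.inl ⟨max_lt hx₁ hy₁, sup_le hx.le.2 hy.le.2⟩)

theorem Prod.sup_lt_of_snd_lt (hx : x < d) (hy : y < d) (hx₂ : x.2 < d.2) (hy₂ : y.2 < d.2) :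
    x ⊔ y < d :=
  Prod.lt_iff.2 (Or.inr ⟨sup_le hx.le.1 hy.le.1, max_lt hx₂ hy₂⟩)

theorem Prod.fst_lt_or_snd_lt_of_lt (h : x < d) : x.1 < d.1 ∨ x.2 < d.2 :=
  (Prod.lt_iff.1 h).imp And.left And.right

/-- The product of two linear orders has degree 2: among three elements strictly below `d`,
two are strictly below `d` in the same coordinate. -/
theorem Degree2.prod (α β : Type*) [LinearOrder α] [LinearOrder β] : Degree2 (α × β) := by
  intro d x₁ x₂ x₃ h₁ h₂ h₃
  have key : x₁ ⊔ x₂ < d ∨ x₁ ⊔ x₃ < d ∨ x₂ ⊔ x₃ < d := by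
    rcases Prod.fst_lt_or_snd_lt_of_lt h₁ with k₁ | k₁ <;>
      rcases Prod.fst_lt_or_snd_lt_of_lt h₂ with k₂ | k₂ <;>
      rcases Prod.fst_lt_or_snd_lt_of_lt h₃ with k₃ | k₃ <;>
      first
      | exact Or.inl (Prod.sup_lt_of_fst_lt h₁ h₂ k₁ k₂)
      | exact Or.inl (Prod.sup_lt_of_snd_lt h₁ h₂ k₁ k₂)
      | exact Or.inr (Or.inl (Prod.sup_lt_of_fst_lt h₁ h₃ k₁ k₃))
      | exact Or.inr (Or.inl (Prod.sup_lt_of_snd_lt h₁ h₃ k₁ k₃))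
      | exact Or.inr (Or.inr (Prod.sup_lt_of_fst_lt h₂ h₃ k₂ k₃))
      | exact Or.inr (Or.inr (Prod.sup_lt_of_snd_lt h₂ h₃ k₂ k₃))
  rcases key with h | h | h
  · exact ⟨_, h, Or.inl ⟨le_sup_left, le_sup_right⟩⟩
  · exact ⟨_, h, Or.inr (Or.inl ⟨le_sup_left, le_sup_right⟩)⟩
  · exact ⟨_, h, Or.inr (Or.inr ⟨le_sup_left, le_sup_right⟩)⟩

end LinearOrder

/-- For any two ordinals `lam0, lam1`, the product `lam0 × lam1` with the componentwise order
is a lattice of degree 2. -/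
theorem stmt4 (lam0 lam1 : Ordinal) :
    Degree2 (↥(Set.Iio lam0) × ↥(Set.Iio lam1)) :=
  Degree2.prod _ _
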